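/- Fix X ∈ {0,1}^{m×n} and u ∈ {0,1}^m. Define v* ∈ {0,1}^n by v*_j = 1 if (X_{:j})·u > h(u)/2 and v*_j = 0 otherwise. Then for every v ∈ {0,1}^n, h(X ⊕ u(v*)^T) ≤ h(X ⊕ uv^T); i.e., the Proximus v-update globally minimizes the rank-one XOR approximation cost over v for fixed u. -/

import Mathlib

open Finset

/-- Hamming weight of a binary vector. -/
def hW {m : ℕ} (x : Fin m → Bool) : ℕ :=
  (univ.filter fun i => x i = true).card

/-- Hamming weight of a binary matrix. -/
def hM {m n : ℕ} (X : Fin m → Fin n → Bool) : ℕ :=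
  (univ.filter fun p : Fin m × Fin n => X p.1 p.2 = true).card

/-- Integer inner product of two binary vectors. -/
def dotB {m : ℕ} (x y : Fin m → Bool) : ℕ :=
  (univ.filter fun i => (x i && y i) = true).card

/-- Cost h(X ⊕ u vᵀ) of the rank-one XOR approximation. -/
def cost {m n : ℕ} (X : Fin m → Fin n → Bool) (u : Fin m → Bool) (v : Fin n → Bool) : ℕ :=
  hM (fun i j => xor (X i j) (u i && v j))

theorem hM_eq_sum_hW {m n : ℕ} (X : Fin m → Fin n → Bool) :
    hM X = ∑ j, hW fun i => X i j := by
  simp only [hM, hW, card_filter]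
  exact Fintype.sum_prod_type_right _

theorem hW_xor_add_two_mul_dotB {m : ℕ} (x y : Fin m → Bool) :
    hW (fun i => xor (x i) (y i)) + 2 * dotB x y = hW x + hW y := by
  simp only [hW, dotB, card_filter, mul_sum, ← sum_add_distrib]
  refine sum_congr rfl fun i _ => ?_
  cases x i <;> cases y i <;> rfl

/-- the Proximus v-update globally minimizes the rank-one XOR
approximation cost over v, for fixed u. -/
theorem proximus_v_update_global_min {m n : ℕ}
    (X : Fin m → Fin n → Bool) (u : Fin m → Bool)
    (vstar : Fin n → Bool)
    (hvstar : ∀ j, vstar j = decide ((dotB (fun i => X i j) u : ℚ) > (hW u : ℚ) / 2)) :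
    ∀ v : Fin n → Bool, cost X u vstar ≤ cost X u v := by
  intro v
  simp only [cost, hM_eq_sum_hW]
  refine sum_le_sum fun j _ => ?_
  have hx := hW_xor_add_two_mul_dotB (fun i => X i j) u
  have hj := hvstar j
  cases hs : vstar j <;> cases v j <;> rw [hs] at hj <;>
    simp only [Bool.and_true, Bool.and_false, Bool.xor_false]
  · have hle := not_lt.mp (of_decide_eq_false hj.symm)
    rw [le_div_iff₀ two_pos] at hle
    norm_cast at hle
    lia
  · have hlt := of_decide_eq_true hj.symm
    rw [gt_iff_lt, div_lt_iff₀ two_pos] at hlt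
    norm_cast at hlt
    lia
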